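/- For every acceptance mode (σ,ρ) with σ ∈ {ran, inf} and ρ ∈ {⊓, ⊆, =}, the family of ω-languages (σ,ρ,l)-accepted by right linear ω-grammars equals the family of ω-languages (σ,ρ)-accepted by finite state ω-automata: 𝓛_{σ,ρ,l}(ω-RLG) = 𝓛_{σ,ρ}(ω-FSA). -/

import Mathlib

namespace OmegaFormal

/-- σ component of an acceptance mode: `ran` (occurs at least once)
or `inf` (occurs infinitely often). -/
inductive AccSigma | ran | inf
deriving DecidableEq

/-- ρ component of an acceptance mode: `cap` (nonempty intersection, ⊓),
`sub` (⊆) or `eq` (=). -/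
inductive AccRho | cap | sub | eq
deriving DecidableEq

/-- derivation mode: leftmost (`l`) or normal (`nl`). -/
inductive DerivMode | l | nl
deriving DecidableEq

/-- `sigmaSet σ f` is ran(f) resp. inf(f). -/
def sigmaSet {Q : Type _} : AccSigma → (ℕ → Q) → Set Q
  | .ran, f => Set.range f
  | .inf, f => {q | ∀ n : ℕ, ∃ m : ℕ, n ≤ m ∧ f m = q}

/-- the binary relation denoted by ρ. -/
def rhoRel {Q : Type _} : AccRho → Set Q → Set Q → Prop
  | .cap, A, B => (A ∩ B).Nonempty
  | .sub, A, B => A ⊆ B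
  | .eq,  A, B => A = B

/-- f is (σ,ρ)-accepting w.r.t. the set 𝓕 of designated sets. -/
def IsAccepting {Q : Type _} (σ : AccSigma) (ρ : AccRho) (𝓕 : Set (Set Q)) (f : ℕ → Q) : Prop :=
  ∃ F ∈ 𝓕, rhoRel ρ (sigmaSet σ f) F

/-- the finite word `l` coincides with the prefix of the ω-word `u`. -/
def MatchesPrefix {T : Type _} (l : List T) (u : ℕ → T) : Prop :=
  ∀ (k : ℕ) (h : k < l.length), l.get ⟨k, h⟩ = u k

/-- the maximal terminal prefix of a sentential form. -/
def termPrefix {N T : Type _} : List (N ⊕ T) → List T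
  | [] => []
  | (Sum.inl _) :: _ => []
  | (Sum.inr a) :: l => a :: termPrefix l

/-- A phrase structure ω-grammar `G = (N, T, P, S, 𝓕)`:
`N` nonterminals, `T` terminals, `P` named productions `p : lhs p → rhs p`
with `lhs p ∈ N⁺`, `rhs p ∈ (N ∪ T)*`, start symbol, and
production repetition sets `acc ⊆ 2^P`. -/
structure OmegaPSG (T : Type) where
  N : Type
  [fintypeN : Fintype N]
  P : Type
  [fintypeP : Fintype P]
  lhs : P → List N
  lhs_ne : ∀ p : P, lhs p ≠ []
  rhs : P → List (N ⊕ T)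
  start : N
  acc : Set (Set P)

namespace OmegaPSG

variable {T : Type} (G : OmegaPSG T)

/-- one (normal) rewriting step using production p. -/
def Step (p : G.P) (x y : List (G.N ⊕ T)) : Prop :=
  ∃ u v : List (G.N ⊕ T),
    x = u ++ (G.lhs p).map Sum.inl ++ v ∧ y = u ++ G.rhs p ++ v

/-- one leftmost rewriting step: the rewritten occurrence starts at the
leftmost nonterminal, i.e. everything to its left is terminal. -/
def LStep (p : G.P) (x y : List (G.N ⊕ T)) : Prop :=
  ∃ u v : List (G.N ⊕ T), (∀ s ∈ u, ∃ a : T, s = Sum.inr a) ∧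
    x = u ++ (G.lhs p).map Sum.inl ++ v ∧ y = u ++ G.rhs p ++ v

def StepOf : DerivMode → G.P → List (G.N ⊕ T) → List (G.N ⊕ T) → Prop
  | .l => G.LStep
  | .nl => G.Step

/-- `L_{σ,ρ,π}(G)`: ω-words admitting an infinite π-derivation from S whose
growing terminal prefixes spell the word and whose production sequence is
(σ,ρ)-accepting w.r.t. `G.acc`. -/
def Lang (σ : AccSigma) (ρ : AccRho) (π : DerivMode) : Set (ℕ → T) :=
  {u | ∃ (s : ℕ → List (G.N ⊕ T)) (d : ℕ → G.P),
    s 0 = [Sum.inl G.start] ∧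
    (∀ i : ℕ, G.StepOf π (d i) (s i) (s (i + 1))) ∧
    (∀ n : ℕ, ∃ i : ℕ, n ≤ (termPrefix (s i)).length) ∧
    (∀ i : ℕ, MatchesPrefix (termPrefix (s i)) u) ∧
    IsAccepting σ ρ G.acc d}

/-- context-free: every left-hand side is a single nonterminal. -/
def IsCFG : Prop := ∀ p : G.P, (G.lhs p).length = 1

/-- context-sensitive (monotonic): `|β| ≥ |α|` for every production. -/
def IsCSG : Prop := ∀ p : G.P, (G.lhs p).length ≤ (G.rhs p).length

/-- right linear: productions of the form `A → uB` or `A → u`, `u ∈ T*`. -/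
def IsRLG : Prop :=
  ∀ p : G.P, (G.lhs p).length = 1 ∧
    ∃ (w : List T) (B : Option G.N),
      G.rhs p = w.map Sum.inr ++ B.toList.map Sum.inl

/-- `G` is a grammar with `$`-boundary (PSG version): with `$` = `dollar`,
`S` = `S'`, every production has one of the forms
(1) α → β, α,β ∈ N⁺ (N = nonterminals other than `$`, `S`),
(2) S → $α, α ∈ N⁺, (3) $A → a$, (4) A → ε. -/
def HasDollarBoundary (dollar S' : G.N) : Prop :=
  dollar ≠ S' ∧ G.start = S' ∧
  ∀ p : G.P,
    ((dollar ∉ G.lhs p ∧ S' ∉ G.lhs p) ∧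
      ∃ β : List G.N, β ≠ [] ∧ dollar ∉ β ∧ S' ∉ β ∧ G.rhs p = β.map Sum.inl) ∨
    (G.lhs p = [S'] ∧ ∃ α : List G.N, α ≠ [] ∧ dollar ∉ α ∧ S' ∉ α ∧
      G.rhs p = Sum.inl dollar :: α.map Sum.inl) ∨
    (∃ A : G.N, A ≠ dollar ∧ A ≠ S' ∧ G.lhs p = [dollar, A] ∧
      ∃ a : T, G.rhs p = [Sum.inr a, Sum.inl dollar]) ∨
    (∃ A : G.N, A ≠ dollar ∧ A ≠ S' ∧ G.lhs p = [A] ∧ G.rhs p = [])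

/-- `G` is a grammar with `$`-boundary (CSG version): forms (1)-(3) only,
with `|α| ≤ |β|` in form (1). -/
def HasDollarBoundaryCSG (dollar S' : G.N) : Prop :=
  dollar ≠ S' ∧ G.start = S' ∧
  ∀ p : G.P,
    ((dollar ∉ G.lhs p ∧ S' ∉ G.lhs p) ∧
      ∃ β : List G.N, β ≠ [] ∧ dollar ∉ β ∧ S' ∉ β ∧ (G.lhs p).length ≤ β.length ∧
        G.rhs p = β.map Sum.inl) ∨
    (G.lhs p = [S'] ∧ ∃ α : List G.N, α ≠ [] ∧ dollar ∉ α ∧ S' ∉ α ∧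
      G.rhs p = Sum.inl dollar :: α.map Sum.inl) ∨
    (∃ A : G.N, A ≠ dollar ∧ A ≠ S' ∧ G.lhs p = [dollar, A] ∧
      ∃ a : T, G.rhs p = [Sum.inr a, Sum.inl dollar])

end OmegaPSG

/-- `𝓛_{σ,ρ,π}(X)` for the family `X` of ω-grammars over `T` satisfying `C`. -/
def GLang (T : Type) (C : OmegaPSG T → Prop) (σ : AccSigma) (ρ : AccRho) (π : DerivMode) :
    Set (Set (ℕ → T)) :=
  {L | ∃ G : OmegaPSG T, C G ∧ L = G.Lang σ ρ π}

/-- number of non-ε labels among `b 0, …, b (i-1)`. -/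
def someCount {A : Type _} (b : ℕ → Option A) (i : ℕ) : ℕ :=
  ((Finset.range i).filter fun j => (b j).isSome = true).card

/-- the (ε-allowing) label sequence `b` concatenates to the ω-word `u`. -/
def Spells {A : Type _} (b : ℕ → Option A) (u : ℕ → A) : Prop :=
  (∀ n : ℕ, ∃ i : ℕ, n ≤ someCount b i) ∧
  ∀ i : ℕ, ∀ a : A, b i = some a → a = u (someCount b i)

/-- A finite state ω-automaton `(Q, Σ, δ, q₀, 𝓕)`. -/
structure OmegaFSA (Sig : Type) where
  Q : Type
  [fintypeQ : Fintype Q]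
  init : Q
  trans : Q → Option Sig → Q → Prop
  acc : Set (Set Q)

/-- `L_{σ,ρ}(A)` for a finite state ω-automaton. -/
def OmegaFSA.Lang {Sig : Type} (A : OmegaFSA Sig) (σ : AccSigma) (ρ : AccRho) :
    Set (ℕ → Sig) :=
  {u | ∃ (r : ℕ → A.Q) (b : ℕ → Option Sig),
    r 0 = A.init ∧ (∀ i : ℕ, A.trans (r i) (b i) (r (i + 1))) ∧
    Spells b u ∧ IsAccepting σ ρ A.acc r}

/-- `𝓛_{σ,ρ}(ω-FSA)`. -/
def FSALang (Sig : Type) (σ : AccSigma) (ρ : AccRho) : Set (Set (ℕ → Sig)) :=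
  {L | ∃ A : OmegaFSA Sig, L = A.Lang σ ρ}

/-- A pushdown ω-automaton `(Q, Σ, Γ, δ, q₀, Z₀, 𝓕)`. -/
structure OmegaPDA (Sig : Type) where
  Q : Type
  [fintypeQ : Fintype Q]
  Γ : Type
  [fintypeΓ : Fintype Γ]
  init : Q
  Z0 : Γ
  trans : Q → Option Sig → Γ → Q → List Γ → Prop
  acc : Set (Set Q)

/-- `L_{σ,ρ}(D)` for a pushdown ω-automaton. -/
def OmegaPDA.Lang {Sig : Type} (D : OmegaPDA Sig) (σ : AccSigma) (ρ : AccRho) :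
    Set (ℕ → Sig) :=
  {u | ∃ (q : ℕ → D.Q) (st : ℕ → List D.Γ) (b : ℕ → Option Sig),
    q 0 = D.init ∧ st 0 = [D.Z0] ∧
    (∀ i : ℕ, ∃ (Z : D.Γ) (γ rest : List D.Γ),
      st i = Z :: rest ∧ D.trans (q i) (b i) Z (q (i + 1)) γ ∧ st (i + 1) = γ ++ rest) ∧
    Spells b u ∧ IsAccepting σ ρ D.acc q}

/-- `𝓛_{σ,ρ}(ω-PDA)`. -/
def PDALang (Sig : Type) (σ : AccSigma) (ρ : AccRho) : Set (Set (ℕ → Sig)) :=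
  {L | ∃ D : OmegaPDA Sig, L = D.Lang σ ρ}

/-- tape head moves. -/
inductive Move | L | R | S
deriving DecidableEq

def moveHead : Move → ℕ → ℕ
  | .L, n => n - 1
  | .R, n => n + 1
  | .S, n => n

/-- A single-tape Turing ω-machine `(Q, Σ, Γ, δ, q₀, 𝓕)` (Σ ⊆ Γ via `embed`). -/
structure OmegaTM (Sig : Type) where
  Q : Type
  [fintypeQ : Fintype Q]
  Γ : Type
  [fintypeΓ : Fintype Γ]
  embed : Sig → Γ
  embed_inj : Function.Injective embed
  init : Q
  trans : Q → Γ → Q → Γ → Move → Prop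
  acc : Set (Set Q)

/-- `L_{σ,ρ}(M)`: ω-words admitting a complete non-oscillating run whose state
sequence is (σ,ρ)-accepting. -/
def OmegaTM.Lang {Sig : Type} (M : OmegaTM Sig) (σ : AccSigma) (ρ : AccRho) :
    Set (ℕ → Sig) :=
  {u | ∃ (q : ℕ → M.Q) (tape : ℕ → ℕ → M.Γ) (pos : ℕ → ℕ),
    q 0 = M.init ∧ (∀ n : ℕ, tape 0 n = M.embed (u n)) ∧ pos 0 = 0 ∧
    (∀ i : ℕ, ∃ (g : M.Γ) (m : Move),
      M.trans (q i) (tape i (pos i)) (q (i + 1)) g m ∧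
      tape (i + 1) = Function.update (tape i) (pos i) g ∧
      pos (i + 1) = moveHead m (pos i)) ∧
    (∀ n : ℕ, ∃ i : ℕ, n ≤ pos i) ∧
    (∀ n : ℕ, ∃ i0 : ℕ, ∀ i : ℕ, i0 ≤ i → pos i ≠ n) ∧
    IsAccepting σ ρ M.acc q}

/-- `𝓛_{σ,ρ}(ω-TM)`. -/
def TMLang (Sig : Type) (σ : AccSigma) (ρ : AccRho) : Set (Set (ℕ → Sig)) :=
  {L | ∃ M : OmegaTM Sig, L = M.Lang σ ρ}

/-- An m-tape Turing ω-machine. -/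
structure OmegaMTM (m : ℕ) (Sig : Type) where
  Q : Type
  [fintypeQ : Fintype Q]
  Γ : Type
  [fintypeΓ : Fintype Γ]
  embed : Sig → Γ
  embed_inj : Function.Injective embed
  blank : Γ
  init : Q
  trans : Q → (Fin m → Γ) → Q → (Fin m → Γ) → (Fin m → Move) → Prop
  acc : Set (Set Q)

/-- `L_{σ,ρ}(M)` for an m-tape Turing ω-machine (`hm : 0 < m`; the input is on
the first tape, the other tapes are initially blank; the run must be complete
and non-oscillating on the first tape). -/
def OmegaMTM.Lang {m : ℕ} {Sig : Type} (M : OmegaMTM m Sig) (hm : 0 < m)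
    (σ : AccSigma) (ρ : AccRho) : Set (ℕ → Sig) :=
  {u | ∃ (q : ℕ → M.Q) (tape : ℕ → Fin m → ℕ → M.Γ) (pos : ℕ → Fin m → ℕ),
    q 0 = M.init ∧
    (∀ n : ℕ, tape 0 ⟨0, hm⟩ n = M.embed (u n)) ∧
    (∀ j : Fin m, j ≠ ⟨0, hm⟩ → ∀ n : ℕ, tape 0 j n = M.blank) ∧
    (∀ j : Fin m, pos 0 j = 0) ∧
    (∀ i : ℕ, ∃ (g : Fin m → M.Γ) (mv : Fin m → Move),
      M.trans (q i) (fun j => tape i j (pos i j)) (q (i + 1)) g mv ∧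
      (∀ j : Fin m, tape (i + 1) j = Function.update (tape i j) (pos i j) (g j)) ∧
      (∀ j : Fin m, pos (i + 1) j = moveHead (mv j) (pos i j))) ∧
    (∀ n : ℕ, ∃ i : ℕ, n ≤ pos i ⟨0, hm⟩) ∧
    (∀ n : ℕ, ∃ i0 : ℕ, ∀ i : ℕ, i0 ≤ i → pos i ⟨0, hm⟩ ≠ n) ∧
    IsAccepting σ ρ M.acc q}

/-- `𝓛_{σ,ρ}(m-ω-TM)`. -/
def MTMLang (Sig : Type) (m : ℕ) (hm : 0 < m) (σ : AccSigma) (ρ : AccRho) :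
    Set (Set (ℕ → Sig)) :=
  {L | ∃ M : OmegaMTM m Sig, L = M.Lang hm σ ρ}

/-- the ω-language `{aⁿbⁿ | n ≥ 1}^ω` over the alphabet `Bool`
(`false` = a, `true` = b). -/
def abLang : Set (ℕ → Bool) :=
  {u | ∃ n : ℕ → ℕ, (∀ i : ℕ, 1 ≤ n i) ∧
    ∀ i k : ℕ, k < 2 * n i →
      u ((∑ j ∈ Finset.range i, 2 * n j) + k) = decide (n i ≤ k)}

end OmegaFormal

namespace OmegaFormal

section Words

variable {T : Type}

/-- The concatenation of the words `f 0, …, f (i - 1)`. -/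
def concatPrefix (f : ℕ → List T) : ℕ → List T
  | 0 => []
  | i + 1 => concatPrefix f i ++ f i

theorem matchesPrefix_append {l l' : List T} {u : ℕ → T} :
    MatchesPrefix (l ++ l') u ↔
      MatchesPrefix l u ∧ ∀ (k : ℕ) (h : k < l'.length), l'[k] = u (l.length + k) := by
  simp only [MatchesPrefix, List.get_eq_getElem, List.length_append]
  constructor
  · intro H
    refine ⟨fun k h => ?_, fun k h => ?_⟩
    · rw [← H k (by omega), List.getElem_append_left h]
    · rw [← H (l.length + k) (by omega), List.getElem_append_right (by omega)]
      simp
  · rintro ⟨H, H'⟩ k h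
    by_cases hk : k < l.length
    · rw [List.getElem_append_left hk, H k hk]
    · rw [List.getElem_append_right (by omega), H']
      congr 1
      omega

theorem forall_matchesPrefix_concatPrefix (f : ℕ → List T) (u : ℕ → T) :
    (∀ i, MatchesPrefix (concatPrefix f i) u) ↔
      ∀ (i k : ℕ) (h : k < (f i).length), (f i)[k] = u ((concatPrefix f i).length + k) := by
  constructor
  · intro H i
    exact (matchesPrefix_append.1 (H (i + 1))).2
  · intro H i
    induction i with
    | zero => intro k h; simp [concatPrefix] at h
    | succ i ih => exact matchesPrefix_append.2 ⟨ih, H i⟩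

theorem someCount_succ (b : ℕ → Option T) (i : ℕ) :
    someCount b (i + 1) = someCount b i + (b i).toList.length := by
  unfold someCount
  rw [Finset.range_add_one, Finset.filter_insert]
  cases h : b i <;> simp

theorem length_concatPrefix_toList (b : ℕ → Option T) (i : ℕ) :
    (concatPrefix (fun j => (b j).toList) i).length = someCount b i := by
  induction i with
  | zero => simp [concatPrefix, someCount]
  | succ i ih => simp [concatPrefix, someCount_succ, ih]

end Words

theorem termPrefix_map_inr_append {N T : Type} (x : List T) (C : Option N) :
    termPrefix (x.map Sum.inr ++ C.toList.map Sum.inl) = x := by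
  induction x with
  | nil => cases C <;> simp [termPrefix]
  | cons a x ih => simpa [termPrefix] using ih

theorem map_inr_append_eq {N T : Type} {x : List T} {C : Option N} {A : N}
    {y v : List (N ⊕ T)} (hy : ∀ s ∈ y, ∃ a : T, s = Sum.inr a)
    (h : x.map Sum.inr ++ C.toList.map Sum.inl = y ++ [Sum.inl A] ++ v) :
    C = some A ∧ y = x.map Sum.inr ∧ v = [] := by
  induction x generalizing y with
  | nil =>
    cases y with
    | nil => cases C <;> simp_all
    | cons s y =>
      obtain ⟨a, rfl⟩ := hy s (by simp)
      cases C <;> simp at h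
  | cons a x ih =>
    cases y with
    | nil => simp at h
    | cons s y =>
      simp only [List.map_cons, List.cons_append, List.cons.injEq] at h
      obtain ⟨h₁, h₂, h₃⟩ := ih (fun s hs => hy s (by simp [hs])) h.2
      exact ⟨h₁, by simp [h₂, h.1], h₃⟩

namespace OmegaPSG

variable {T : Type} {G : OmegaPSG T} {src : G.P → G.N} {word : G.P → List T}
  {tgt : G.P → Option G.N}

theorem lStep_rightLinear_iff (hl : ∀ p, G.lhs p = [src p])
    (hr : ∀ p, G.rhs p = (word p).map Sum.inr ++ (tgt p).toList.map Sum.inl)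
    (p : G.P) (x : List T) (C : Option G.N) (y : List (G.N ⊕ T)) :
    G.LStep p (x.map Sum.inr ++ C.toList.map Sum.inl) y ↔
      C = some (src p) ∧ y = (x ++ word p).map Sum.inr ++ (tgt p).toList.map Sum.inl := by
  constructor
  · rintro ⟨y₁, v, hy, hx, rfl⟩
    rw [hl] at hx
    obtain ⟨rfl, rfl, rfl⟩ := map_inr_append_eq hy hx
    simp [hr]
  · rintro ⟨rfl, rfl⟩
    exact ⟨x.map Sum.inr, [], by simp, by simp [hl], by simp [hr]⟩

/-- The leftmost language of a right linear grammar, described by production sequences alone. -/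
theorem mem_lang_rightLinear_iff (hl : ∀ p, G.lhs p = [src p])
    (hr : ∀ p, G.rhs p = (word p).map Sum.inr ++ (tgt p).toList.map Sum.inl)
    (σ : AccSigma) (ρ : AccRho) (u : ℕ → T) :
    u ∈ G.Lang σ ρ .l ↔ ∃ d : ℕ → G.P,
      src (d 0) = G.start ∧ (∀ i, tgt (d i) = some (src (d (i + 1)))) ∧
      (∀ n, ∃ i, n ≤ (concatPrefix (fun i => word (d i)) i).length) ∧
      (∀ (i k : ℕ) (h : k < (word (d i)).length),
        (word (d i))[k] = u ((concatPrefix (fun i => word (d i)) i).length + k)) ∧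
      IsAccepting σ ρ G.acc d := by
  constructor
  · rintro ⟨s, d, h0, hs, hlen, hpre, hacc⟩
    have hform : ∀ i, s i = (concatPrefix (fun i => word (d i)) i).map Sum.inr ++
        [Sum.inl (src (d i))] ∧
        s (i + 1) = (concatPrefix (fun i => word (d i)) (i + 1)).map Sum.inr ++
          (tgt (d i)).toList.map Sum.inl ∧ (i = 0 → src (d 0) = G.start) := by
      intro i
      induction i with
      | zero =>
        have h := hs 0
        rw [h0] at h
        obtain ⟨h₁, h₂⟩ := (lStep_rightLinear_iff hl hr (d 0) [] (some G.start) _).1 h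
        rw [Option.some.injEq] at h₁
        exact ⟨by simp [h0, h₁, concatPrefix], h₂, fun _ => h₁.symm⟩
      | succ i ih =>
        have h := hs (i + 1)
        rw [ih.2.1] at h
        obtain ⟨h₁, h₂⟩ := (lStep_rightLinear_iff hl hr _ _ _ _).1 h
        exact ⟨by rw [ih.2.1, h₁]; simp, h₂, by simp⟩
    have hterm : ∀ i, termPrefix (s i) = concatPrefix (fun i => word (d i)) i := by
      intro i
      rw [(hform i).1]
      exact termPrefix_map_inr_append _ (some (src (d i)))
    refine ⟨d, (hform 0).2.2 rfl, fun i => ?_, ?_, ?_, hacc⟩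
    · have h := (hform i).2.1.symm.trans (hform (i + 1)).1
      rw [List.append_cancel_left_eq] at h
      cases ht : tgt (d i) <;> simp_all
    · simpa only [hterm] using hlen
    · simp only [hterm] at hpre
      exact (forall_matchesPrefix_concatPrefix _ _).1 hpre
  · rintro ⟨d, h0, hd, hlen, hpre, hacc⟩
    have hterm : ∀ i, termPrefix ((concatPrefix (fun i => word (d i)) i).map Sum.inr ++
        [Sum.inl (src (d i))]) = concatPrefix (fun i => word (d i)) i := fun i =>
      termPrefix_map_inr_append _ (some (src (d i)))
    refine ⟨fun i => (concatPrefix (fun i => word (d i)) i).map Sum.inr ++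
      [Sum.inl (src (d i))], d, by simp [concatPrefix, h0], fun i => ?_, ?_, ?_, hacc⟩
    · refine (lStep_rightLinear_iff hl hr (d i) _ (some (src (d i))) _).2 ⟨rfl, ?_⟩
      simp [hd i, concatPrefix]
    · simpa only [hterm] using hlen
    · simp only [hterm]
      exact (forall_matchesPrefix_concatPrefix _ _).2 hpre

end OmegaPSG

section AutomatonToGrammar

theorem sigmaSet_comp {P Q : Type} [Finite P] (σ : AccSigma) (g : P → Q) (d : ℕ → P) :
    sigmaSet σ (fun i => g (d i)) = g '' sigmaSet σ d := by
  cases σ with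
  | ran => exact Set.range_comp g d
  | inf =>
    ext q
    constructor
    · intro hq
      by_contra hno
      have hbound : ∀ p, ∃ n, ∀ m, n ≤ m → d m = p → g p ≠ q := by
        intro p
        by_contra! hp
        have hgp : g p = q := by
          obtain ⟨m, -, -, h⟩ := hp 0
          exact h
        exact hno ⟨p, fun n => (hp n).imp fun m hm => ⟨hm.1, hm.2.1⟩, hgp⟩
      choose n hn using hbound
      obtain ⟨N, hN⟩ := (Set.finite_range n).bddAbove
      obtain ⟨m, hm, hmq⟩ := hq N
      exact hn (d m) m ((hN ⟨d m, rfl⟩).trans hm) rfl hmq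
    · rintro ⟨p, hp, rfl⟩ n
      obtain ⟨m, hm, rfl⟩ := hp n
      exact ⟨m, hm, rfl⟩

/-- Designated sets for sequences whose image under `g` is to be accepted with respect to `𝓕`. -/
def pullAcc {P Q : Type} (ρ : AccRho) (g : P → Q) (𝓕 : Set (Set Q)) : Set (Set P) :=
  match ρ with
  | .eq => {D | g '' D ∈ 𝓕}
  | _ => Set.preimage g '' 𝓕

theorem isAccepting_pullAcc {P Q : Type} [Finite P] (σ : AccSigma) (ρ : AccRho) (g : P → Q)
    (𝓕 : Set (Set Q)) (d : ℕ → P) :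
    IsAccepting σ ρ (pullAcc ρ g 𝓕) d ↔ IsAccepting σ ρ 𝓕 (fun i => g (d i)) := by
  unfold IsAccepting
  rw [sigmaSet_comp σ g d]
  cases ρ with
  | eq => simp [pullAcc, rhoRel]
  | sub => simp [pullAcc, rhoRel]
  | cap => simp [pullAcc, rhoRel, Set.image_inter_nonempty_iff]

variable {T : Type} [Fintype T]

open Classical in
/-- The right linear grammar with one production `q → a q'` per transition. -/
noncomputable def OmegaFSA.toGrammar (A : OmegaFSA T) (ρ : AccRho) : OmegaPSG T :=
  letI := A.fintypeQ
  { N := A.Q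
    P := {x : A.Q × Option T × A.Q // A.trans x.1 x.2.1 x.2.2}
    lhs := fun p => [p.1.1]
    lhs_ne := by simp
    rhs := fun p => p.1.2.1.toList.map Sum.inr ++ (some p.1.2.2).toList.map Sum.inl
    start := A.init
    acc := pullAcc ρ (fun p => p.1.1) A.acc }

theorem OmegaFSA.toGrammar_isRLG (A : OmegaFSA T) (ρ : AccRho) : (A.toGrammar ρ).IsRLG :=
  fun p => ⟨rfl, p.1.2.1.toList, some p.1.2.2, rfl⟩

theorem OmegaFSA.toGrammar_lang (A : OmegaFSA T) (σ : AccSigma) (ρ : AccRho) :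
    (A.toGrammar ρ).Lang σ ρ .l = A.Lang σ ρ := by
  have : Finite (A.toGrammar ρ).P := by
    let := (A.toGrammar ρ).fintypeP
    infer_instance
  ext u
  rw [OmegaPSG.mem_lang_rightLinear_iff (G := A.toGrammar ρ) (src := fun p => p.1.1)
    (word := fun p => p.1.2.1.toList) (tgt := fun p => some p.1.2.2)
    (fun _ => rfl) (fun _ => rfl)]
  constructor
  · rintro ⟨d, h0, hd, hlen, hpre, hacc⟩
    refine ⟨fun i => (d i).1.1, fun i => (d i).1.2.1, h0, fun i => ?_, ⟨?_, ?_⟩,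
      (isAccepting_pullAcc σ ρ _ _ d).1 hacc⟩
    · have h := (d i).2
      rwa [Option.some.inj (hd i)] at h
    · intro n
      obtain ⟨i, hi⟩ := hlen n
      exact ⟨i, hi.trans_eq (length_concatPrefix_toList _ i)⟩
    · intro i a ha
      have h := hpre i 0 (by simp [ha])
      rw [length_concatPrefix_toList (fun i => (d i).1.2.1)] at h
      simpa [ha] using h
  · rintro ⟨r, b, h0, hr, ⟨hlen, hb⟩, hacc⟩
    let d : ℕ → (A.toGrammar ρ).P := fun i => ⟨(r i, b i, r (i + 1)), hr i⟩
    refine ⟨d, h0, fun i => rfl, fun n => ?_, fun i k hk => ?_,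
      (isAccepting_pullAcc σ ρ _ _ d).2 hacc⟩
    · obtain ⟨i, hi⟩ := hlen n
      exact ⟨i, hi.trans_eq (length_concatPrefix_toList _ i).symm⟩
    · change k < (b i).toList.length at hk
      change (b i).toList[k] = u ((concatPrefix (fun i => (b i).toList) i).length + k)
      rw [length_concatPrefix_toList]
      rcases Option.eq_none_or_eq_some (b i) with hbi | ⟨a, hbi⟩
      · simp [hbi] at hk
      · obtain rfl : k = 0 := by simpa [hbi] using hk
        simpa [hbi] using hb i a hbi

end AutomatonToGrammar

section Blocks

variable {T : Type}

/-- The time at which the block of states spelling `f i` begins: the block has one state more than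
`f i` has letters, and time `0` is taken by the initial state. -/
def blockStart (f : ℕ → List T) (i : ℕ) : ℕ := (concatPrefix f i).length + i + 1

theorem blockStart_succ (f : ℕ → List T) (i : ℕ) :
    blockStart f (i + 1) = blockStart f i + (f i).length + 1 := by
  simp [blockStart, concatPrefix]
  omega

theorem lt_blockStart (f : ℕ → List T) (i : ℕ) : i < blockStart f i := by
  unfold blockStart
  omega

theorem blockStart_strictMono (f : ℕ → List T) : StrictMono (blockStart f) :=
  strictMono_nat_of_lt_succ fun i => by rw [blockStart_succ]; omega

theorem blockStart_add_lt (f : ℕ → List T) {i j k : ℕ} (hij : i < j) (hk : k ≤ (f i).length) :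
    blockStart f i + k < blockStart f j := by
  have := (blockStart_strictMono f).monotone (Nat.succ_le_of_lt hij)
  rw [Nat.succ_eq_add_one, blockStart_succ] at this
  omega

theorem exists_eq_blockStart_add (f : ℕ → List T) (t : ℕ) :
    ∃ i k, k ≤ (f i).length ∧ t + 1 = blockStart f i + k := by
  induction t with
  | zero => exact ⟨0, 0, by simp, by simp [blockStart, concatPrefix]⟩
  | succ t ih =>
    obtain ⟨i, k, hk, ht⟩ := ih
    rcases hk.lt_or_eq with hk | rfl
    · exact ⟨i, k + 1, hk, by omega⟩
    · exact ⟨i + 1, 0, by simp, by rw [blockStart_succ]; omega⟩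

theorem blockStart_add_inj (f : ℕ → List T) {i j k l : ℕ} (hk : k ≤ (f i).length)
    (hl : l ≤ (f j).length) (h : blockStart f i + k = blockStart f j + l) : i = j ∧ k = l := by
  rcases lt_trichotomy i j with hij | rfl | hij
  · have := blockStart_add_lt f hij hk
    omega
  · exact ⟨rfl, by omega⟩
  · have := blockStart_add_lt f hij hl
    omega

theorem someCount_blockStart_add {f : ℕ → List T} {b : ℕ → Option T} (h0 : b 0 = none)
    (hb : ∀ i k, k ≤ (f i).length → b (blockStart f i + k) = (f i)[k]?) (i k : ℕ)
    (hk : k ≤ (f i).length) :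
    someCount b (blockStart f i + k) = (concatPrefix f i).length + k := by
  induction i generalizing k with
  | zero =>
    induction k with
    | zero => simp [blockStart, concatPrefix, someCount_succ, h0]; simp [someCount]
    | succ k ih =>
      rw [← add_assoc, someCount_succ, ih (by omega), hb 0 k (by omega),
        List.getElem?_eq_getElem hk]
      simp [add_assoc]
  | succ i ihi =>
    induction k with
    | zero =>
      rw [add_zero, blockStart_succ, someCount_succ, ihi _ le_rfl, hb i _ le_rfl]
      simp [concatPrefix]
    | succ k ih =>
      rw [← add_assoc, someCount_succ, ih (by omega), hb (i + 1) k (by omega),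
        List.getElem?_eq_getElem hk]
      simp [add_assoc]

theorem spells_blocks_iff {f : ℕ → List T} {b : ℕ → Option T} (h0 : b 0 = none)
    (hb : ∀ i k, k ≤ (f i).length → b (blockStart f i + k) = (f i)[k]?) (u : ℕ → T) :
    Spells b u ↔ (∀ n, ∃ i, n ≤ (concatPrefix f i).length) ∧
      ∀ (i k : ℕ) (_ : k < (f i).length), (f i)[k] = u ((concatPrefix f i).length + k) := by
  have hcount := someCount_blockStart_add h0 hb
  constructor
  · rintro ⟨hlen, hu⟩
    refine ⟨fun n => ?_, fun i k h => ?_⟩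
    · obtain ⟨t, ht⟩ := hlen n
      cases t with
      | zero => exact ⟨0, by simpa [someCount, concatPrefix] using ht⟩
      | succ t =>
        obtain ⟨i, k, hk, hik⟩ := exists_eq_blockStart_add f t
        refine ⟨i + 1, ?_⟩
        rw [hik, hcount i k hk] at ht
        simp only [concatPrefix, List.length_append]
        omega
    · rw [← hcount i k h.le]
      exact hu _ _ (by rw [hb i k h.le, List.getElem?_eq_getElem h])
  · rintro ⟨hlen, hu⟩
    refine ⟨fun n => ?_, fun t a ha => ?_⟩
    · obtain ⟨i, hi⟩ := hlen n
      exact ⟨blockStart f i, hi.trans_eq (hcount i 0 (by simp)).symm⟩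
    · cases t with
      | zero => simp [h0] at ha
      | succ t =>
        obtain ⟨i, k, hk, hik⟩ := exists_eq_blockStart_add f t
        rw [hik, hb i k hk] at ha
        obtain ⟨h, rfl⟩ := List.getElem?_eq_some_iff.1 ha
        rw [hik, hcount i k hk, hu i k h]

end Blocks

section GrammarToAutomaton

variable {T P N : Type}

/-- States of the automaton simulating right linear productions with terminal words `word p`:
an initial state, and for each production one state per position in its word. -/
abbrev BlockState (word : P → List T) : Type := Option (Σ p : P, Fin ((word p).length + 1))

/-- The state in which `k` letters of `word p` have been read. -/
def blockState (word : P → List T) (p : P) (k : ℕ) : BlockState word := some ⟨p, Fin.ofNat _ k⟩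

theorem blockState_inj {word : P → List T} {p q : P} {k l : ℕ} (hk : k ≤ (word p).length)
    (hl : l ≤ (word q).length) (h : blockState word p k = blockState word q l) :
    p = q ∧ k = l := by
  simp only [blockState, Option.some.injEq, Sigma.mk.injEq] at h
  obtain ⟨rfl, h⟩ := h
  have := congrArg Fin.val (eq_of_heq h)
  simp only [Fin.val_ofNat] at this
  rw [Nat.mod_eq_of_lt (by omega), Nat.mod_eq_of_lt (by omega)] at this
  exact ⟨rfl, this⟩

theorem some_eq_blockState {word : P → List T} (p : P) (k : Fin ((word p).length + 1)) :
    (some ⟨p, k⟩ : BlockState word) = blockState word p k := by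
  simp [blockState]

/-- The states of the blocks of the productions in `X`, with the initial state added if `c`. -/
def blockSet (word : P → List T) (c : Prop) (X : Set P) : Set (BlockState word) :=
  {s | s.elim c fun x => x.1 ∈ X}

theorem rhoRel_blockSet (word : P → List T) (σ : AccSigma) (ρ : AccRho) (X F : Set P) :
    rhoRel ρ (blockSet word (σ = .ran) X) (blockSet word (σ = .ran ∧ ρ ≠ .cap) F) ↔
      rhoRel ρ X F := by
  have hmem : ∀ c Y p, (some ⟨p, 0⟩ : BlockState word) ∈ blockSet word c Y ↔ p ∈ Y :=
    fun _ _ _ => Iff.rfl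
  cases ρ with
  | cap =>
    constructor
    · rintro ⟨_ | x, h₁, h₂⟩
      · exact absurd rfl h₂.2
      · exact ⟨x.1, h₁, h₂⟩
    · rintro ⟨p, h₁, h₂⟩
      exact ⟨some ⟨p, 0⟩, h₁, h₂⟩
  | sub =>
    constructor
    · intro h p hp
      exact (hmem _ _ p).1 (h ((hmem _ _ p).2 hp))
    · rintro h (_ | x) hx
      · exact ⟨hx, by simp⟩
      · exact h hx
  | eq =>
    constructor
    · intro h
      change blockSet _ _ _ = blockSet _ _ _ at h
      ext p
      rw [← hmem (σ = .ran) X p, h, hmem]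
    · intro h
      change X = F at h
      subst h
      simp [rhoRel]

theorem sigmaSet_blocks {word : P → List T} {d : ℕ → P} {r : ℕ → BlockState word}
    (h0 : r 0 = none)
    (hr : ∀ i k, k ≤ (word (d i)).length →
      r (blockStart (fun i => word (d i)) i + k) = blockState word (d i) k) (σ : AccSigma) :
    sigmaSet σ r = blockSet word (σ = .ran) (sigmaSet σ d) := by
  set f := fun i => word (d i)
  have hpos : ∀ t, ∃ i k, k ≤ (f i).length ∧ t + 1 = blockStart f i + k ∧
      r (t + 1) = blockState word (d i) k := by
    intro t
    obtain ⟨i, k, hk, hik⟩ := exists_eq_blockStart_add f t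
    exact ⟨i, k, hk, hik, by rw [hik, hr i k hk]⟩
  ext s
  cases σ with
  | ran =>
    rcases s with _ | ⟨p, k⟩
    · exact ⟨fun _ => rfl, fun _ => ⟨0, h0⟩⟩
    · constructor
      · rintro ⟨_ | t, ht⟩
        · simp [h0] at ht
        · obtain ⟨i, l, hl, -, hil⟩ := hpos t
          rw [hil, some_eq_blockState] at ht
          exact ⟨i, (blockState_inj (word := word) hl (by omega) ht).1⟩
      · rintro ⟨i, hi⟩
        obtain rfl : d i = p := hi
        exact ⟨_, by rw [some_eq_blockState, hr i k (by omega)]⟩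
  | inf =>
    rcases s with _ | ⟨p, k⟩
    · constructor
      · intro h
        obtain ⟨_ | t, ht, htn⟩ := h 1
        · omega
        · obtain ⟨i, l, -, -, hil⟩ := hpos t
          simp [hil, blockState] at htn
      · intro h
        cases h
    · constructor
      · intro h n
        obtain ⟨_ | t, ht, htp⟩ := h (blockStart f n)
        · simp [h0] at htp
        · obtain ⟨i, l, hl, hil, hril⟩ := hpos t
          rw [hril, some_eq_blockState] at htp
          refine ⟨i, ?_, (blockState_inj (word := word) hl (by omega) htp).1⟩
          by_contra! hin
          have := blockStart_add_lt f hin hl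
          omega
      · intro h n
        obtain ⟨i, hi, hip⟩ := h n
        subst hip
        refine ⟨blockStart f i + k, ?_, by rw [some_eq_blockState, hr i k (by omega)]⟩
        have := lt_blockStart f i
        omega

/-- Transitions of the automaton simulating the productions `src p → word p (tgt p)`. -/
inductive BlockTrans (start : N) (src : P → N) (word : P → List T) (tgt : P → Option N) :
    BlockState word → Option T → BlockState word → Prop
  | init (p : P) (h : src p = start) :
      BlockTrans start src word tgt none none (blockState word p 0)
  | read (p : P) (k : ℕ) (h : k < (word p).length) :
      BlockTrans start src word tgt (blockState word p k) (word p)[k]? (blockState word p (k + 1))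
  | next (p q : P) (h : tgt p = some (src q)) :
      BlockTrans start src word tgt (blockState word p (word p).length) none (blockState word q 0)

variable {start : N} {src : P → N} {word : P → List T} {tgt : P → Option N}

theorem BlockTrans.of_none {o : Option T} {s : BlockState word}
    (h : BlockTrans start src word tgt none o s) :
    o = none ∧ ∃ p, src p = start ∧ s = blockState word p 0 := by
  generalize hx : (none : BlockState word) = x at h
  cases h with
  | init p h => exact ⟨rfl, p, h, rfl⟩
  | read p k h => simp [blockState] at hx
  | next p q h => simp [blockState] at hx

theorem BlockTrans.of_blockState {p : P} {k : ℕ} {o : Option T} {s : BlockState word}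
    (hk : k ≤ (word p).length)
    (h : BlockTrans start src word tgt (blockState word p k) o s) :
    o = (word p)[k]? ∧ (k < (word p).length → s = blockState word p (k + 1)) ∧
      (k = (word p).length → ∃ q, tgt p = some (src q) ∧ s = blockState word q 0) := by
  generalize hx : blockState word p k = x at h
  cases h with
  | init q h => simp [blockState] at hx
  | read q l h =>
    obtain ⟨rfl, rfl⟩ := blockState_inj hk h.le hx
    exact ⟨rfl, fun _ => rfl, fun h' => by omega⟩
  | next q q' h =>
    obtain ⟨rfl, rfl⟩ := blockState_inj hk le_rfl hx
    exact ⟨by simp, fun h' => by omega, fun _ => ⟨q', h, rfl⟩⟩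

/-- Every run of the block automaton arises from a sequence of composable productions. -/
theorem exists_productions_of_run {r : ℕ → BlockState word} {b : ℕ → Option T}
    (h0 : r 0 = none) (hr : ∀ t, BlockTrans start src word tgt (r t) (b t) (r (t + 1))) :
    ∃ d : ℕ → P, src (d 0) = start ∧ (∀ i, tgt (d i) = some (src (d (i + 1)))) ∧ b 0 = none ∧
      ∀ i k, k ≤ (word (d i)).length →
        r (blockStart (fun i => word (d i)) i + k) = blockState word (d i) k ∧
        b (blockStart (fun i => word (d i)) i + k) = (word (d i))[k]? := by
  have hblock : ∀ t p, r t = blockState word p 0 → ∀ k, k ≤ (word p).length →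
      r (t + k) = blockState word p k ∧ b (t + k) = (word p)[k]? := by
    intro t p ht k hk
    have hrk : r (t + k) = blockState word p k := by
      induction k with
      | zero => exact ht
      | succ k ih =>
        have h := hr (t + k)
        rw [ih (by omega)] at h
        exact (h.of_blockState (by omega)).2.1 (by omega)
    refine ⟨hrk, ?_⟩
    have h := hr (t + k)
    rw [hrk] at h
    exact (h.of_blockState hk).1
  have hnext : ∀ x : {x : ℕ × P // r x.1 = blockState word x.2 0},
      ∃ y : {y : ℕ × P // r y.1 = blockState word y.2 0},
        y.1.1 = x.1.1 + (word x.1.2).length + 1 ∧ tgt x.1.2 = some (src y.1.2) := by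
    rintro ⟨⟨t, p⟩, ht⟩
    have h := hr (t + (word p).length)
    rw [(hblock t p ht _ le_rfl).1] at h
    obtain ⟨q, hq, hs⟩ := (h.of_blockState le_rfl).2.2 rfl
    exact ⟨⟨(_, q), hs⟩, rfl, hq⟩
  choose next hnext using hnext
  have hinit := hr 0
  rw [h0] at hinit
  obtain ⟨hb0, p, hp, hp0⟩ := hinit.of_none
  let c : ℕ → {x : ℕ × P // r x.1 = blockState word x.2 0} :=
    fun i => next^[i] ⟨(0 + 1, p), hp0⟩
  have hc : ∀ i, c (i + 1) = next (c i) := fun i => Function.iterate_succ_apply' next i _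
  have htime : ∀ i, (c i).1.1 = blockStart (fun i => word (c i).1.2) i := by
    intro i
    induction i with
    | zero => simp [c, blockStart, concatPrefix]
    | succ i ih => rw [hc, (hnext _).1, ih, blockStart_succ]
  refine ⟨fun i => (c i).1.2, hp, fun i => ?_, hb0, fun i k hk => ?_⟩
  · simp only [hc]
    exact (hnext _).2
  · rw [← htime]
    exact hblock _ _ (c i).2 k hk

/-- Every sequence of composable productions induces a run of the block automaton. -/
theorem exists_run_of_productions {d : ℕ → P} (h0 : src (d 0) = start)
    (hd : ∀ i, tgt (d i) = some (src (d (i + 1)))) :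
    ∃ (r : ℕ → BlockState word) (b : ℕ → Option T), r 0 = none ∧ b 0 = none ∧
      (∀ t, BlockTrans start src word tgt (r t) (b t) (r (t + 1))) ∧
      ∀ i k, k ≤ (word (d i)).length →
        r (blockStart (fun i => word (d i)) i + k) = blockState word (d i) k ∧
        b (blockStart (fun i => word (d i)) i + k) = (word (d i))[k]? := by
  set f := fun i => word (d i)
  choose I K hK hIK using exists_eq_blockStart_add f
  let r : ℕ → BlockState word := fun t => t.casesOn none fun t => blockState word (d (I t)) (K t)
  let b : ℕ → Option T := fun t => t.casesOn none fun t => (f (I t))[K t]?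
  have hrb : ∀ i k, k ≤ (f i).length →
      r (blockStart f i + k) = blockState word (d i) k ∧ b (blockStart f i + k) = (f i)[k]? := by
    intro i k hk
    obtain ⟨t, ht⟩ : ∃ t, blockStart f i + k = t + 1 := ⟨blockStart f i + k - 1, by
      have := lt_blockStart f i
      omega⟩
    obtain ⟨rfl, rfl⟩ := blockStart_add_inj f hk (hK t) (ht.trans (hIK t))
    rw [ht]
    exact ⟨rfl, rfl⟩
  refine ⟨r, b, rfl, rfl, fun t => ?_, hrb⟩
  cases t with
  | zero =>
    have h : r (0 + 1) = blockState word (d 0) 0 := (hrb 0 0 (by simp)).1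
    rw [h]
    exact .init _ h0
  | succ t =>
    obtain ⟨i, k, hk, hik⟩ := exists_eq_blockStart_add f t
    rw [hik, (hrb i k hk).1, (hrb i k hk).2]
    rcases hk.lt_or_eq with hk | rfl
    · rw [add_assoc, (hrb i (k + 1) hk).1]
      exact .read _ _ hk
    · have h := (hrb (i + 1) 0 (by simp)).1
      rw [add_zero, blockStart_succ] at h
      rw [h, List.getElem?_eq_none le_rfl]
      exact .next _ _ (hd i)

/-- The automaton simulating a right linear grammar with productions `src p → word p (tgt p)`. -/
def OmegaPSG.toAutomaton (G : OmegaPSG T) (src : G.P → G.N) (word : G.P → List T)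
    (tgt : G.P → Option G.N) (σ : AccSigma) (ρ : AccRho) : OmegaFSA T :=
  letI := G.fintypeP
  { Q := BlockState word
    init := none
    trans := BlockTrans G.start src word tgt
    acc := blockSet word (σ = .ran ∧ ρ ≠ .cap) '' G.acc }

theorem OmegaPSG.toAutomaton_lang (G : OmegaPSG T) {src : G.P → G.N} {word : G.P → List T}
    {tgt : G.P → Option G.N} (hl : ∀ p, G.lhs p = [src p])
    (hr : ∀ p, G.rhs p = (word p).map Sum.inr ++ (tgt p).toList.map Sum.inl)
    (σ : AccSigma) (ρ : AccRho) :
    (G.toAutomaton src word tgt σ ρ).Lang σ ρ = G.Lang σ ρ .l := by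
  have hacc : ∀ (d : ℕ → G.P) (r : ℕ → BlockState word),
      sigmaSet σ r = blockSet word (σ = .ran) (sigmaSet σ d) →
      (IsAccepting σ ρ (G.toAutomaton src word tgt σ ρ).acc r ↔ IsAccepting σ ρ G.acc d) := by
    intro d r h
    change (∃ F ∈ blockSet word _ '' G.acc, rhoRel ρ (sigmaSet σ r) F) ↔ _
    rw [h]
    exact Set.exists_mem_image.trans
      (exists_congr fun F => and_congr_right fun _ => rhoRel_blockSet word σ ρ _ F)
  ext u
  rw [mem_lang_rightLinear_iff hl hr]
  constructor
  · rintro ⟨r, b, h0, hrun, hspell, ha⟩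
    obtain ⟨d, hd0, hd, hb0, hrb⟩ := exists_productions_of_run h0 hrun
    obtain ⟨h₁, h₂⟩ := (spells_blocks_iff (f := fun i => word (d i)) hb0
      (fun i k hk => (hrb i k hk).2) u).1 hspell
    exact ⟨d, hd0, hd, h₁, h₂,
      (hacc d r (sigmaSet_blocks h0 (fun i k hk => (hrb i k hk).1) σ)).1 ha⟩
  · rintro ⟨d, hd0, hd, h₁, h₂, ha⟩
    obtain ⟨r, b, h0, hb0, hrun, hrb⟩ := exists_run_of_productions (word := word) hd0 hd
    exact ⟨r, b, h0, hrun, (spells_blocks_iff (f := fun i => word (d i)) hb0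
      (fun i k hk => (hrb i k hk).2) u).2 ⟨h₁, h₂⟩,
      (hacc d r (sigmaSet_blocks h0 (fun i k hk => (hrb i k hk).1) σ)).2 ha⟩

end GrammarToAutomaton

end OmegaFormal

open OmegaFormal

/-- Theorem (ω-RLG vs ω-FSA, leftmost derivations):
𝓛_{σ,ρ,l}(ω-RLG) = 𝓛_{σ,ρ}(ω-FSA) for every acceptance mode (σ,ρ). -/
theorem rlg_l_eq_fsa (T : Type) [Fintype T] (σ : AccSigma) (ρ : AccRho) :
    GLang T OmegaPSG.IsRLG σ ρ DerivMode.l = FSALang T σ ρ := by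
  ext L
  constructor
  · rintro ⟨G, hG, rfl⟩
    choose hlen word tgt hr using hG
    choose src hl using fun p => List.length_eq_one_iff.1 (hlen p)
    exact ⟨G.toAutomaton src word tgt σ ρ, (G.toAutomaton_lang hl hr σ ρ).symm⟩
  · rintro ⟨A, rfl⟩
    exact ⟨A.toGrammar ρ, A.toGrammar_isRLG ρ, (A.toGrammar_lang σ ρ).symm⟩
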